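/- arXiv:1211.4597 — 2 statements merged into one kernel-verified Lean document; each statement's English description precedes it below -/
import Mathlib

section
/- Let α ∈ ℂ be any root of the polynomial X⁴ + 4X³ − 132X² + 44X + 121. Then α lies in the subfield ℚ(α²) generated over ℚ by α²; equivalently, ℚ(α²) = ℚ(α). -/
/-- Any complex root `α` of `X⁴ + 4X³ − 132X² + 44X + 121` lies in the
subfield `ℚ(α²)`, i.e. `ℚ(α²) = ℚ(α)`. -/
theorem root_mem_adjoin_sq (α : ℂ)
    (h : α ^ 4 + 4 * α ^ 3 - 132 * α ^ 2 + 44 * α + 121 = 0) :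
    α ∈ IntermediateField.adjoin ℚ ({α ^ 2} : Set ℂ) := by
  have hne : 4 * α ^ 2 + 44 ≠ 0 := by
    intro h0
    have hcontra : (1694 : ℂ) = 0 := by
      linear_combination h - (α ^ 2 / 4 + α - 143 / 4) * h0
    norm_num at hcontra
  have hα : α = -((α ^ 2) ^ 2 - 132 * α ^ 2 + 121) / (4 * α ^ 2 + 44) := by
    rw [eq_div_iff hne]
    linear_combination h
  have hmem : α ^ 2 ∈ IntermediateField.adjoin ℚ ({α ^ 2} : Set ℂ) :=
    IntermediateField.mem_adjoin_simple_self ℚ (α ^ 2)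
  generalize IntermediateField.adjoin ℚ ({α ^ 2} : Set ℂ) = K at hmem ⊢
  rw [hα]
  exact div_mem
    (neg_mem (add_mem (sub_mem (pow_mem hmem 2) (mul_mem (ofNat_mem K 132) hmem))
      (ofNat_mem K 121)))
    (add_mem (mul_mem (ofNat_mem K 4) hmem) (ofNat_mem K 44))
end

section
/- If rational numbers x, y, z, w satisfy 4x² − 2y² − 10z² − 20w² = 0, then x = y = z = w = 0. -/
theorem ZMod.five_sq_anisotropic : ∀ a b : ZMod 5,
    (2 * a ^ 2 - b ^ 2 = 0 → a = 0 ∧ b = 0) ∧ (a ^ 2 + 2 * b ^ 2 = 0 → a = 0 ∧ b = 0) := by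
  decide

theorem Int.five_dvd_of_five_dvd_two_mul_sq_sub_sq {a b : ℤ} (h : 5 ∣ 2 * a ^ 2 - b ^ 2) :
    5 ∣ a ∧ 5 ∣ b := by
  have key := (ZMod.five_sq_anisotropic a b).1
  have h' := (ZMod.intCast_zmod_eq_zero_iff_dvd (2 * a ^ 2 - b ^ 2) 5).2 h
  push_cast at h'
  exact ⟨(ZMod.intCast_zmod_eq_zero_iff_dvd a 5).1 (key h').1,
    (ZMod.intCast_zmod_eq_zero_iff_dvd b 5).1 (key h').2⟩

theorem Int.five_dvd_of_five_dvd_sq_add_two_mul_sq {a b : ℤ} (h : 5 ∣ a ^ 2 + 2 * b ^ 2) :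
    5 ∣ a ∧ 5 ∣ b := by
  have key := (ZMod.five_sq_anisotropic a b).2
  have h' := (ZMod.intCast_zmod_eq_zero_iff_dvd (a ^ 2 + 2 * b ^ 2) 5).2 h
  push_cast at h'
  exact ⟨(ZMod.intCast_zmod_eq_zero_iff_dvd a 5).1 (key h').1,
    (ZMod.intCast_zmod_eq_zero_iff_dvd b 5).1 (key h').2⟩

theorem five_pow_dvd_of_picard_form_eq_zero (n : ℕ) (x y z w : ℤ)
    (h : 4 * x ^ 2 - 2 * y ^ 2 - 10 * z ^ 2 - 20 * w ^ 2 = 0) :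
    5 ^ n ∣ x ∧ 5 ^ n ∣ y ∧ 5 ^ n ∣ z ∧ 5 ^ n ∣ w := by
  induction n generalizing x y z w with
  | zero => simp
  | succ n ih =>
    obtain ⟨⟨x, rfl⟩, ⟨y, rfl⟩⟩ := Int.five_dvd_of_five_dvd_two_mul_sq_sub_sq
      (a := x) (b := y) ⟨z ^ 2 + 2 * w ^ 2, by linarith⟩
    obtain ⟨⟨z, rfl⟩, ⟨w, rfl⟩⟩ := Int.five_dvd_of_five_dvd_sq_add_two_mul_sq
      (a := z) (b := w) ⟨2 * x ^ 2 - y ^ 2, by linarith⟩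
    obtain ⟨hx, hy, hz, hw⟩ := ih x y z w (by linarith)
    rw [pow_succ']
    exact ⟨mul_dvd_mul_left 5 hx, mul_dvd_mul_left 5 hy, mul_dvd_mul_left 5 hz,
      mul_dvd_mul_left 5 hw⟩

theorem Int.eq_zero_of_forall_five_pow_dvd {a : ℤ} (h : ∀ n : ℕ, 5 ^ n ∣ a) : a = 0 := by
  refine Int.eq_zero_of_abs_lt_dvd (h a.natAbs) ?_
  rw [Int.abs_eq_natAbs]
  exact_mod_cast Nat.lt_pow_self (by norm_num : 1 < 5)

theorem picard_form_anisotropic_int (x y z w : ℤ)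
    (h : 4 * x ^ 2 - 2 * y ^ 2 - 10 * z ^ 2 - 20 * w ^ 2 = 0) :
    x = 0 ∧ y = 0 ∧ z = 0 ∧ w = 0 := by
  have key n := five_pow_dvd_of_picard_form_eq_zero n x y z w h
  exact ⟨Int.eq_zero_of_forall_five_pow_dvd fun n => (key n).1,
    Int.eq_zero_of_forall_five_pow_dvd fun n => (key n).2.1,
    Int.eq_zero_of_forall_five_pow_dvd fun n => (key n).2.2.1,
    Int.eq_zero_of_forall_five_pow_dvd fun n => (key n).2.2.2⟩

/-- The intersection form `diag(4, −2, −10, −20)` of the Picard lattice is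
anisotropic over `ℚ`. -/
theorem picard_form_anisotropic (x y z w : ℚ)
    (h : 4 * x ^ 2 - 2 * y ^ 2 - 10 * z ^ 2 - 20 * w ^ 2 = 0) :
    x = 0 ∧ y = 0 ∧ z = 0 ∧ w = 0 := by
  obtain ⟨⟨d, hd⟩, hint⟩ :=
    IsLocalization.exist_integer_multiples_of_finset (nonZeroDivisors ℤ) ({x, y, z, w} : Finset ℚ)
  have hd0 : (d : ℚ) ≠ 0 := by exact_mod_cast nonZeroDivisors.ne_zero hd
  obtain ⟨a, ha⟩ := hint x (by simp)
  obtain ⟨b, hb⟩ := hint y (by simp)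
  obtain ⟨c, hc⟩ := hint z (by simp)
  obtain ⟨e, he⟩ := hint w (by simp)
  simp only [eq_intCast, zsmul_eq_mul] at ha hb hc he
  have hz : 4 * a ^ 2 - 2 * b ^ 2 - 10 * c ^ 2 - 20 * e ^ 2 = 0 := by
    have : (4 * a ^ 2 - 2 * b ^ 2 - 10 * c ^ 2 - 20 * e ^ 2 : ℚ) = 0 := by
      rw [ha, hb, hc, he]
      linear_combination (d : ℚ) ^ 2 * h
    exact_mod_cast this
  obtain ⟨rfl, rfl, rfl, rfl⟩ := picard_form_anisotropic_int a b c e hz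
  simpa [hd0, eq_comm] using And.intro ha (And.intro hb (And.intro hc he))
end
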